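/- Assume (H2) and (H3), and fix ξ̃ > 0 such that F(σ) > 0 and 1 + 2κσ h'(σ)² > 0 for all σ ∈ (r0², r0² + ξ̃]. Then there exists a constant C > 0, depending only on r0, κ, f, h, ξ̃, such that for all complex numbers z, w with |z|² ≤ r0² + ξ̃: |w|² + F(|z|²) + (κ/2)·(2 h'(|z|²)·Re(conj(z)·w))² ≥ C·(|w|² + (|z|² − r0²)²). -/

import Mathlib

open MeasureTheory Filter

noncomputable section

/-- `Fnl f r0 σ = ∫_σ^{r0²} f(w) dw`. -/
def Fnl (f : ℝ → ℝ) (r0 : ℝ) (σ : ℝ) : ℝ := ∫ w in σ..(r0 ^ 2), f w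

theorem hasDerivAt_Fnl {f : ℝ → ℝ} (hf : Continuous f) (r0 σ : ℝ) :
    HasDerivAt (Fnl f r0) (-f σ) σ :=
  intervalIntegral.integral_hasDerivAt_left (hf.intervalIntegrable _ _)
    hf.stronglyMeasurable.stronglyMeasurableAtFilter hf.continuousAt

/-- A function with a critical zero and positive second derivative at `a` dominates a positive
multiple of `(x - a) ^ 2` near `a`. -/
theorem exists_eventually_mul_sq_le {F : ℝ → ℝ} {a : ℝ} (hF : Differentiable ℝ F)
    (hF' : DifferentiableAt ℝ (deriv F) a) (h0 : F a = 0) (h1 : deriv F a = 0)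
    (h2 : 0 < deriv (deriv F) a) :
    ∃ c : ℝ, 0 < c ∧ ∀ᶠ x in nhds a, c * (x - a) ^ 2 ≤ F x := by
  set c := deriv (deriv F) a / 4 with hc
  refine ⟨c, by positivity, ?_⟩
  have hd : deriv (fun x => F x - c * (x - a) ^ 2) = fun x => deriv F x - c * (2 * (x - a)) := by
    funext x
    have hq : HasDerivAt (fun x => c * (x - a) ^ 2) (c * (2 * (x - a))) x := by
      simpa using (((hasDerivAt_id x).sub_const a).pow 2).const_mul c
    exact ((hF x).hasDerivAt.sub hq).deriv
  have hdd : deriv (deriv fun x => F x - c * (x - a) ^ 2) a = deriv (deriv F) a - c * 2 := by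
    rw [hd]
    have hq : HasDerivAt (fun x => c * (2 * (x - a))) (c * 2) a := by
      simpa using (((hasDerivAt_id a).sub_const a).const_mul 2).const_mul c
    exact (hF'.hasDerivAt.sub hq).deriv
  have hmin : IsLocalMin (fun x => F x - c * (x - a) ^ 2) a := by
    apply isLocalMin_of_deriv_deriv_pos
    · rw [hdd]; linarith
    · rw [hd]; simp [h1]
    · exact (hF a).continuousAt.sub (by fun_prop)
  filter_upwards [hmin] with x hx
  simp only [h0, sub_self] at hx
  linarith

/-- A local quadratic lower bound extends to a compact set on which the function is positive
away from `a`. -/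
theorem IsCompact.exists_mul_sq_le {F : ℝ → ℝ} {a : ℝ} {K : Set ℝ} (hK : IsCompact K)
    (hF : Continuous F) (hpos : ∀ x ∈ K, x ≠ a → 0 < F x)
    (hloc : ∃ c : ℝ, 0 < c ∧ ∀ᶠ x in nhds a, c * (x - a) ^ 2 ≤ F x) :
    ∃ c : ℝ, 0 < c ∧ ∀ x ∈ K, c * (x - a) ^ 2 ≤ F x := by
  obtain ⟨c, hc, hev⟩ := hloc
  obtain ⟨U, hU, hUo, haU⟩ := eventually_nhds_iff.mp hev
  have hq : ContinuousOn (fun x => F x / (x - a) ^ 2) (K \ U) := by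
    refine hF.continuousOn.div (by fun_prop) fun x hx => ?_
    exact pow_ne_zero 2 (sub_ne_zero.mpr fun h => hx.2 (h ▸ haU))
  obtain ⟨d, hd, hdF⟩ := (hK.diff hUo).exists_forall_le' hq (a := 0) fun x hx =>
    have hne : x ≠ a := fun h => hx.2 (h ▸ haU)
    div_pos (hpos x hx.1 hne) (sq_pos_of_ne_zero (sub_ne_zero.mpr hne))
  refine ⟨min c d, lt_min hc hd, fun x hx => ?_⟩
  by_cases hxU : x ∈ U
  · exact (mul_le_mul_of_nonneg_right (min_le_left c d) (sq_nonneg _)).trans (hU x hxU)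
  · have hne : x ≠ a := fun h => hxU (h ▸ haU)
    refine (mul_le_mul_of_nonneg_right (min_le_right c d) (sq_nonneg _)).trans ?_
    exact (le_div_iff₀ (sq_pos_of_ne_zero (sub_ne_zero.mpr hne))).mp (hdF x ⟨hx, hxU⟩)

theorem min_one_mul_norm_sq_le (κ b : ℝ) (z w : ℂ) :
    min 1 (1 + 2 * κ * ‖z‖ ^ 2 * b ^ 2) * ‖w‖ ^ 2 ≤
      ‖w‖ ^ 2 + κ / 2 * (2 * b * ((starRingEnd ℂ) z * w).re) ^ 2 := by
  have hre : ((starRingEnd ℂ) z * w).re ^ 2 ≤ ‖z‖ ^ 2 * ‖w‖ ^ 2 := by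
    have h := Complex.abs_re_le_norm ((starRingEnd ℂ) z * w)
    rw [norm_mul, Complex.norm_conj] at h
    rw [← mul_pow, ← sq_abs]
    gcongr
  set t := ((starRingEnd ℂ) z * w).re
  rcases le_total 0 κ with hκ | hκ
  · have h1 := mul_le_mul_of_nonneg_right
      (min_le_left 1 (1 + 2 * κ * ‖z‖ ^ 2 * b ^ 2)) (sq_nonneg ‖w‖)
    have h2 : 0 ≤ κ / 2 * (2 * b * t) ^ 2 := by positivity
    linarith
  · have h1 := mul_le_mul_of_nonneg_right
      (min_le_right 1 (1 + 2 * κ * ‖z‖ ^ 2 * b ^ 2)) (sq_nonneg ‖w‖)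
    have h2 := mul_le_mul_of_nonpos_left hre
      (mul_nonpos_of_nonpos_of_nonneg hκ (sq_nonneg b))
    linarith

/-- pointwise coercivity of the energy density.  For `z, w ∈ ℂ` with
`|z|² ≤ r0² + ξ̃`, the quantity `|w|² + F(|z|²) + (κ/2)(2h'(|z|²)Re(z̄w))²`
controls `|w|² + (|z|² − r0²)²`. -/
theorem pointwise_energy_coercivity
    (r0 : ℝ) (hr0 : 0 < r0) (κ : ℝ)
    (f h : ℝ → ℝ) (hf : ContDiff ℝ (⊤ : ℕ∞) f) (hh : ContDiff ℝ (⊤ : ℕ∞) h)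
    (hfr0 : f (r0 ^ 2) = 0)
    (hH2 : ∀ σ ∈ Set.Icc (0:ℝ) (r0 ^ 2), 0 < 1 + 2 * κ * σ * (deriv h σ) ^ 2)
    (hH3 : (∀ σ ∈ Set.Ico (0:ℝ) (r0 ^ 2), 0 < Fnl f r0 σ) ∧
      0 < deriv (deriv (Fnl f r0)) (r0 ^ 2))
    (ξ : ℝ) (hξ : 0 < ξ)
    (hξprop : ∀ σ ∈ Set.Ioc (r0 ^ 2) (r0 ^ 2 + ξ),
      0 < Fnl f r0 σ ∧ 0 < 1 + 2 * κ * σ * (deriv h σ) ^ 2) :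
    ∃ C : ℝ, 0 < C ∧ ∀ z w : ℂ, ‖z‖ ^ 2 ≤ r0 ^ 2 + ξ →
      C * (‖w‖ ^ 2 + (‖z‖ ^ 2 - r0 ^ 2) ^ 2) ≤
        ‖w‖ ^ 2 + Fnl f r0 (‖z‖ ^ 2) +
          κ / 2 * (2 * deriv h (‖z‖ ^ 2) * ((starRingEnd ℂ) z * w).re) ^ 2 := by
  have hF := hasDerivAt_Fnl hf.continuous r0
  have hF' : deriv (Fnl f r0) = fun σ => -f σ := funext fun σ => (hF σ).deriv
  have hFdiff : Differentiable ℝ (Fnl f r0) := fun σ => (hF σ).differentiableAt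
  have hloc := exists_eventually_mul_sq_le hFdiff
    (by rw [hF']; exact (hf.differentiable (by simp)).neg _)
    (by simp [Fnl]) (by simp [hF', hfr0]) hH3.2
  obtain ⟨c, hc, hcF⟩ := (isCompact_Icc (a := 0) (b := r0 ^ 2 + ξ)).exists_mul_sq_le
    hFdiff.continuous (fun σ hσ hne => hne.lt_or_gt.elim (fun hlt => hH3.1 σ ⟨hσ.1, hlt⟩)
      fun hgt => (hξprop σ ⟨hgt, hσ.2⟩).1) hloc
  have hh' : Continuous (deriv h) := hh.continuous_deriv (by simp)
  obtain ⟨m, hm, hmh⟩ := (isCompact_Icc (a := 0) (b := r0 ^ 2 + ξ)).exists_forall_le'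
    (f := fun σ => 1 + 2 * κ * σ * (deriv h σ) ^ 2) (by fun_prop) (a := 0) fun σ hσ =>
      (le_or_gt σ (r0 ^ 2)).elim (fun hle => hH2 σ ⟨hσ.1, hle⟩)
        fun hgt => (hξprop σ ⟨hgt, hσ.2⟩).2
  refine ⟨min c (min 1 m), by positivity, fun z w hz => ?_⟩
  have hmem : ‖z‖ ^ 2 ∈ Set.Icc 0 (r0 ^ 2 + ξ) := ⟨sq_nonneg _, hz⟩
  have hw := min_one_mul_norm_sq_le κ (deriv h (‖z‖ ^ 2)) z w
  have hmw := mul_le_mul_of_nonneg_right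
    ((min_le_right c (min 1 m)).trans (min_le_min_left 1 (hmh _ hmem))) (sq_nonneg ‖w‖)
  have hcz := mul_le_mul_of_nonneg_right (min_le_left c (min 1 m))
    (sq_nonneg (‖z‖ ^ 2 - r0 ^ 2))
  linarith [hcF _ hmem]

end
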